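/- There exist constants c > 0, K > 0 and n₀ ∈ ℕ such that for every integer n ≥ n₀ and every initial informed set S ⊆ Fin n with c·log n ≤ |S| ≤ n/3, one period (n steps) of the push–pull broadcast started from S enlarges the informed set by a factor 6/5 with probability at least 1 − K/n²: μ_n({ω : |I_ω^S(n)| ≥ (6/5)·|S|}) ≥ 1 − K/n². -/

import Mathlib

open MeasureTheory ProbabilityTheory

noncomputable section

/-- The uniform probability measure on the set of ordered pairs of distinct nodes. -/
def pairUniform (n : ℕ) : Measure (Fin n × Fin n) :=
  uniformOn {p : Fin n × Fin n | p.1 ≠ p.2}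

/-- `μ` is the random-scheduler measure `μ_n`: it is a probability measure on the sequence
space `(Fin n × Fin n)^ℕ` under which the coordinate maps (the pairs selected at each time
step) are mutually independent and each is uniformly distributed on the set of ordered pairs
of distinct nodes, i.e. `μ` is the countable product of the uniform measure on that set. -/
def IsSchedulerMeasure (n : ℕ) (μ : Measure (ℕ → Fin n × Fin n)) : Prop :=
  IsProbabilityMeasure μ ∧
  iIndepFun (fun t (ω : ℕ → Fin n × Fin n) => ω t) μ ∧
  ∀ t : ℕ, Measure.map (fun ω => ω t) μ = pairUniform n

/-- The informed set `I_ω^S(t)` of the push–pull broadcast: starting from `S`, whenever the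
selected pair contains an informed node, both nodes of the pair become informed. -/
def informed (n : ℕ) (ω : ℕ → Fin n × Fin n) (S : Finset (Fin n)) : ℕ → Finset (Fin n)
  | 0 => S
  | t + 1 =>
      let I := informed n ω S t
      if (ω t).1 ∈ I ∨ (ω t).2 ∈ I then insert (ω t).1 (insert (ω t).2 I) else I

lemma informed_congr (n : ℕ) (S : Finset (Fin n)) (ω ω' : ℕ → Fin n × Fin n) (t : ℕ)
    (h : ∀ i < t, ω i = ω' i) : informed n ω S t = informed n ω' S t := by
  induction t with
  | zero => rfl
  | succ t ih =>
    have h1 := ih (fun i hi => h i (by omega))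
    have h2 := h t (by omega)
    simp only [informed, h1, h2]

def stepSet (n : ℕ) (I : Finset (Fin n)) (p : Fin n × Fin n) : Finset (Fin n) :=
  if p.1 ∈ I ∨ p.2 ∈ I then insert p.1 (insert p.2 I) else I

lemma informed_succ' (n : ℕ) (S : Finset (Fin n)) (ω : ℕ → Fin n × Fin n) (t : ℕ) :
    informed n ω S (t + 1) = stepSet n (informed n ω S t) (ω t) := rfl

lemma subset_stepSet (n : ℕ) (I : Finset (Fin n)) (p : Fin n × Fin n) : I ⊆ stepSet n I p := by
  unfold stepSet
  split_ifs
  · intro x hx; simp [hx]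
  · exact subset_rfl

lemma subset_informed (n : ℕ) (S : Finset (Fin n)) (ω : ℕ → Fin n × Fin n) (t : ℕ) :
    S ⊆ informed n ω S t := by
  induction t with
  | zero => exact subset_rfl
  | succ t ih => exact ih.trans (subset_stepSet n _ _)

def crossSet (n : ℕ) (I : Finset (Fin n)) : Finset (Fin n × Fin n) :=
  (I ×ˢ Iᶜ) ∪ (Iᶜ ×ˢ I)

lemma card_stepSet (n : ℕ) (I : Finset (Fin n)) (p : Fin n × Fin n) (hp : p ∈ crossSet n I) :
    I.card + 1 ≤ (stepSet n I p).card := by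
  have hss : I ⊂ stepSet n I p := by
    refine Finset.ssubset_iff_subset_ne.2 ⟨subset_stepSet n I p, ?_⟩
    intro he
    simp only [crossSet, Finset.mem_union, Finset.mem_product, Finset.mem_compl] at hp
    have h1 : p.1 ∈ stepSet n I p ∧ p.2 ∈ stepSet n I p := by
      unfold stepSet
      rw [if_pos (by tauto)]
      simp
    rw [← he] at h1
    tauto
  exact Finset.card_lt_card hss

lemma card_crossSet (n : ℕ) (I : Finset (Fin n)) :
    (crossSet n I).card = 2 * (I.card * (n - I.card)) := by
  unfold crossSet
  rw [Finset.card_union_of_disjoint]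
  · simp [Finset.card_product, Finset.card_compl]; ring
  · rw [Finset.disjoint_left]
    intro p; simp; tauto

def wt (n s : ℕ) (I : Finset (Fin n)) : ENNReal :=
  if 5 * I.card < 6 * s then ENNReal.ofReal (Real.exp (-(I.card : ℝ))) else 0

lemma wt_anti (n s : ℕ) {I J : Finset (Fin n)} (h : I.card ≤ J.card) : wt n s J ≤ wt n s I := by
  unfold wt
  split_ifs with h1 h2
  · apply ENNReal.ofReal_le_ofReal
    apply Real.exp_le_exp.2
    simpa using h
  · omega
  · simp
  · simp

lemma wt_half (n s : ℕ) {I J : Finset (Fin n)} (h : I.card + 1 ≤ J.card) :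
    wt n s J ≤ wt n s I * ENNReal.ofReal (1/2) := by
  unfold wt
  split_ifs with h1 h2
  · rw [← ENNReal.ofReal_mul (Real.exp_pos _).le]
    apply ENNReal.ofReal_le_ofReal
    have h3 : (J.card : ℝ) ≥ I.card + 1 := by exact_mod_cast h
    have h4 : Real.exp (-(J.card : ℝ)) ≤ Real.exp (-(I.card : ℝ)) * Real.exp (-1) := by
      rw [← Real.exp_add]
      apply Real.exp_le_exp.2
      linarith
    have h5 : Real.exp (-1) ≤ 1/2 := by
      rw [Real.exp_neg, one_div]
      apply inv_anti₀ (by norm_num)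
      have := Real.add_one_le_exp (1:ℝ)
      linarith
    have := Real.exp_pos (-(I.card : ℝ))
    nlinarith
  · omega
  · simp
  · simp

lemma card_offDiag' (n : ℕ) : {p : Fin n × Fin n | p.1 ≠ p.2}.ncard = n * (n - 1) := by
  have : {p : Fin n × Fin n | p.1 ≠ p.2} = ((Finset.univ : Finset (Fin n)).offDiag : Set _) := by
    ext p; simp
  rw [this, Set.ncard_coe_finset, Finset.offDiag_card]
  simp [Nat.mul_sub]

lemma pair_prob (n : ℕ) (hn : 2 ≤ n) : IsProbabilityMeasure (pairUniform n) := by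
  unfold pairUniform
  apply uniformOn_isProbabilityMeasure (Set.toFinite _)
  exact ⟨(⟨0, by omega⟩, ⟨1, by omega⟩), by simp⟩

lemma pair_cross (n : ℕ) (hn : 2 ≤ n) (I : Finset (Fin n)) :
    pairUniform n (crossSet n I) =
      ENNReal.ofReal (2 * (I.card * (n - I.card)) / (n * (n - 1)) : ℝ) := by
  unfold pairUniform
  have hI : I.card ≤ n := by simpa using Finset.card_le_univ I
  have hsub : (crossSet n I : Set (Fin n × Fin n)) ⊆ {p : Fin n × Fin n | p.1 ≠ p.2} := by
    intro p hp
    simp only [crossSet, Finset.coe_union, Set.mem_union, Finset.mem_coe, Finset.mem_product,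
      Finset.mem_compl] at hp
    intro he
    rw [he] at hp
    tauto
  rw [uniformOn, cond_apply (Set.toFinite _).measurableSet, Set.inter_eq_right.2 hsub,
    Measure.count_apply_finset, Measure.count_apply (Set.toFinite _).measurableSet,
    ← Set.Finite.cast_ncard_eq (Set.toFinite _), card_offDiag', card_crossSet]
  have h1 : ((2 * (I.card * (n - I.card)) : ℕ) : ℝ) = 2 * (I.card * (n - I.card)) := by
    push_cast [Nat.cast_sub hI]; ring
  have h2 : ((n * (n - 1) : ℕ) : ℝ) = n * (n - 1) := by
    push_cast [Nat.cast_sub (show 1 ≤ n by omega)]; ring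
  have hpos : 0 < n * (n-1) := Nat.mul_pos (by omega) (by omega)
  rw [← h1, ← h2, ENNReal.ofReal_div_of_pos (by exact_mod_cast hpos), ENNReal.ofReal_natCast,
    ENNReal.ofReal_natCast, mul_comm, ENNReal.div_eq_inv_mul, mul_comm]
  simp

lemma step_bound (n : ℕ) (hn : 2 ≤ n) (s : ℕ) (hs : (s : ℝ) ≤ n / 3) (I : Finset (Fin n))
    (hI : s ≤ I.card) :
    ∫⁻ p, wt n s (stepSet n I p) ∂(pairUniform n) ≤
      ENNReal.ofReal (1 - 3 * s / (5 * n)) * wt n s I := by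
  have := pair_prob n hn
  by_cases hlt : 5 * I.card < 6 * s
  swap
  · have h0 : ∀ p, wt n s (stepSet n I p) = 0 := by
      intro p
      have := Finset.card_le_card (subset_stepSet n I p)
      unfold wt
      rw [if_neg (by omega)]
    simp [h0]
  set E : Set (Fin n × Fin n) := (crossSet n I : Set (Fin n × Fin n)) with hE
  have hEm : MeasurableSet E := (Set.toFinite _).measurableSet
  set q : ℝ := (2 * (I.card * (n - I.card)) / (n * (n - 1)) : ℝ) with hq
  have hEq : pairUniform n E = ENNReal.ofReal q := pair_cross n hn I
  have hnR : (2:ℝ) ≤ n := by exact_mod_cast hn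
  have hIR : (s:ℝ) ≤ I.card := by exact_mod_cast hI
  have hltR : 5 * (I.card : ℝ) < 6 * s := by exact_mod_cast hlt
  have hs0 : (0:ℝ) ≤ s := by positivity
  have hqr : 6 * s / (5 * n) ≤ q := by
    rw [hq, div_le_div_iff₀ (by positivity) (by nlinarith)]
    have a1 : (3 * n / 5 : ℝ) ≤ n - I.card := by linarith
    have a2 : (s:ℝ) * (3 * n / 5) ≤ I.card * (n - I.card) := by
      apply mul_le_mul hIR a1 (by positivity) (by positivity)
    have a3 : (s:ℝ) * (n * (n-1)) ≤ s * (n * n) := by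
      apply mul_le_mul_of_nonneg_left _ hs0
      nlinarith
    nlinarith
  have hq0 : 0 ≤ q := le_trans (by positivity) hqr
  have hq1 : q ≤ 1 := by
    have := prob_le_one (μ := pairUniform n) (s := E)
    rw [hEq] at this
    simpa using this
  have hEc : pairUniform n Eᶜ = ENNReal.ofReal (1 - q) := by
    rw [prob_compl_eq_one_sub hEm, hEq, ENNReal.ofReal_sub _ hq0, ENNReal.ofReal_one]
  calc ∫⁻ p, wt n s (stepSet n I p) ∂(pairUniform n)
      ≤ ∫⁻ p, (E.indicator (fun _ => wt n s I * ENNReal.ofReal (1/2)) p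
          + Eᶜ.indicator (fun _ => wt n s I) p) ∂(pairUniform n) := by
        apply lintegral_mono
        intro p
        by_cases hp : p ∈ E
        · simp only [Set.indicator_of_mem hp, Set.indicator_of_notMem (Set.notMem_compl_iff.2 hp),
            add_zero]
          exact wt_half n s (card_stepSet n I p (by simpa [hE] using hp))
        · simp only [Set.indicator_of_notMem hp, Set.indicator_of_mem (Set.mem_compl hp),
            zero_add]
          exact wt_anti n s (Finset.card_le_card (subset_stepSet n I p))
    _ = wt n s I * ENNReal.ofReal (1/2) * ENNReal.ofReal q
          + wt n s I * ENNReal.ofReal (1 - q) := by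
        rw [lintegral_add_left (measurable_const.indicator hEm), lintegral_indicator_const hEm,
          lintegral_indicator_const hEm.compl, hEq, hEc]
    _ = ENNReal.ofReal (1/2 * q + (1 - q)) * wt n s I := by
        rw [mul_assoc, ← ENNReal.ofReal_mul (by norm_num), ← mul_add,
          ← ENNReal.ofReal_add (by positivity) (by linarith), mul_comm]
    _ ≤ _ := by
        gcongr
        have : (3 * s / (5 * n) : ℝ) = (6 * s / (5 * n)) / 2 := by ring
        linarith

lemma informed_meas (n : ℕ) (S : Finset (Fin n)) (t : ℕ) :
    Measurable[_, ⊤] (fun ω : ℕ → Fin n × Fin n => informed n ω S t) := by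
  letI : MeasurableSpace (Finset (Fin n)) := ⊤
  induction t with
  | zero => exact measurable_const
  | succ t ih =>
    have h : Measurable (fun ω : ℕ → Fin n × Fin n => (informed n ω S t, ω t)) :=
      ih.prodMk (measurable_pi_apply t)
    have h2 : Measurable (fun x : Finset (Fin n) × (Fin n × Fin n) => stepSet n x.1 x.2) :=
      measurable_of_finite _
    exact h2.comp h

lemma informed_indep (n : ℕ) (hn : 2 ≤ n) (μ : Measure (ℕ → Fin n × Fin n))
    (hμ : IsSchedulerMeasure n μ) (S : Finset (Fin n)) (t : ℕ) :
    @IndepFun _ _ _ _ ⊤ _ (fun ω : ℕ → Fin n × Fin n => informed n ω S t) (fun ω => ω t) μ := by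
  letI : MeasurableSpace (Finset (Fin n)) := ⊤
  obtain ⟨hp, hi, hm⟩ := hμ
  have h := hi.indepFun_finset (Finset.range t) {t} (by simp)
    (fun i => measurable_pi_apply i)
  let F : (Finset.range t → Fin n × Fin n) → Finset (Fin n) := fun x =>
    informed n (fun i => if h : i ∈ Finset.range t then x ⟨i, h⟩
      else (⟨0, by omega⟩, ⟨0, by omega⟩)) S t
  let G : (({t} : Finset ℕ) → Fin n × Fin n) → Fin n × Fin n := fun x => x ⟨t, by simp⟩
  have h' := h.comp (φ := F) (ψ := G) (measurable_of_finite _) (measurable_of_finite _)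
  have e1 : (fun ω : ℕ → Fin n × Fin n => informed n ω S t) =
      F ∘ (fun ω (i : Finset.range t) => ω i) := by
    funext ω
    apply informed_congr
    intro i hi
    simp [hi]
  rw [e1]
  exact h'

lemma wt_decay (n : ℕ) (hn : 2 ≤ n) (μ : Measure (ℕ → Fin n × Fin n))
    (hμ : IsSchedulerMeasure n μ) (S : Finset (Fin n)) (hs : (S.card : ℝ) ≤ n / 3) (t : ℕ) :
    ∫⁻ ω, wt n S.card (informed n ω S t) ∂μ ≤
      ENNReal.ofReal (1 - 3 * S.card / (5 * n)) ^ t * ENNReal.ofReal (Real.exp (-(S.card : ℝ))) := by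
  letI : MeasurableSpace (Finset (Fin n)) := ⊤
  have := pair_prob n hn
  have := hμ.1
  induction t with
  | zero =>
    simp only [informed, lintegral_const, measure_univ, mul_one, pow_zero, one_mul]
    unfold wt
    split_ifs <;> simp
  | succ t ih =>
    have hI := informed_meas n S t
    have hind := (indepFun_iff_map_prod_eq_prod_map_map hI.aemeasurable
      (measurable_pi_apply t).aemeasurable).1 (informed_indep n hn μ hμ S t)
    have h2 : Measurable (fun x : Finset (Fin n) × (Fin n × Fin n) =>
        wt n S.card (stepSet n x.1 x.2)) := measurable_of_finite _
    calc ∫⁻ ω, wt n S.card (informed n ω S (t+1)) ∂μ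
        = ∫⁻ x, wt n S.card (stepSet n x.1 x.2)
            ∂(μ.map (fun ω => (informed n ω S t, ω t))) := by
          rw [lintegral_map h2 (hI.prodMk (measurable_pi_apply t))]
          rfl
      _ = ∫⁻ ω, ∫⁻ p, wt n S.card (stepSet n (informed n ω S t) p) ∂(pairUniform n) ∂μ := by
          rw [hind, hμ.2.2 t, lintegral_prod _ h2.aemeasurable,
            lintegral_map (measurable_of_finite _) hI]
      _ ≤ ∫⁻ ω, ENNReal.ofReal (1 - 3 * S.card / (5 * n)) * wt n S.card (informed n ω S t) ∂μ := by
          apply lintegral_mono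
          intro ω
          exact step_bound n hn _ hs _ (Finset.card_le_card (subset_informed n S ω t))
      _ = ENNReal.ofReal (1 - 3 * S.card / (5 * n)) *
            ∫⁻ ω, wt n S.card (informed n ω S t) ∂μ :=
          lintegral_const_mul' _ _ ENNReal.ofReal_ne_top
      _ ≤ _ := by
          rw [pow_succ', mul_assoc]
          gcongr

/-- There exist constants `c > 0`, `K > 0` and `n₀` such that for every `n ≥ n₀` and every
initial informed set `S` with `c·log n ≤ |S| ≤ n/3`, one period (`n` steps) of the push–pull
broadcast started from `S` enlarges the informed set by a factor `6/5` with probability at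
least `1 − K/n²`. -/
theorem pushPull_one_period_growth :
    ∃ (c K : ℝ) (n₀ : ℕ), 0 < c ∧ 0 < K ∧
      ∀ n : ℕ, n₀ ≤ n →
        ∀ μ : Measure (ℕ → Fin n × Fin n), IsSchedulerMeasure n μ →
          ∀ S : Finset (Fin n),
            c * Real.log n ≤ (S.card : ℝ) → (S.card : ℝ) ≤ n / 3 →
              μ {ω | (6 / 5 : ℝ) * S.card ≤ ((informed n ω S n).card : ℝ)} ≥
                1 - ENNReal.ofReal (K / n ^ 2) := by
  refine ⟨5, 1, 2, by norm_num, by norm_num, ?_⟩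
  intro n hn μ hμ S hc hs
  have := hμ.1
  have hnR : (2:ℝ) ≤ n := by exact_mod_cast hn
  set A : Set (ℕ → Fin n × Fin n) :=
    {ω | (6 / 5 : ℝ) * S.card ≤ ((informed n ω S n).card : ℝ)} with hA
  have hbad : μ Aᶜ ≤ ENNReal.ofReal (1 / n ^ 2) := by
    have hle : μ Aᶜ ≤ ∫⁻ ω, ENNReal.ofReal (Real.exp (6 / 5 * S.card)) *
        wt n S.card (informed n ω S n) ∂μ := by
      have hm : MeasurableSet Aᶜ := by
        have : A = (fun ω => informed n ω S n) ⁻¹'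
          {I | (6 / 5 : ℝ) * S.card ≤ (I.card : ℝ)} := rfl
        rw [this]
        exact (informed_meas n S n trivial).compl
      rw [← lintegral_indicator_one hm]
      apply lintegral_mono
      intro ω
      by_cases hω : ω ∈ Aᶜ
      · rw [Set.indicator_of_mem hω]
        have h1 : ((informed n ω S n).card : ℝ) < 6 / 5 * S.card := by
          simpa [hA] using hω
        have h2 : 5 * (informed n ω S n).card < 6 * S.card := by
          have : 5 * ((informed n ω S n).card : ℝ) < 6 * S.card := by linarith
          exact_mod_cast this
        simp only [wt, if_pos h2, Pi.one_apply]
        rw [← ENNReal.ofReal_mul (Real.exp_pos _).le, ← Real.exp_add, ENNReal.one_le_ofReal]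
        apply Real.one_le_exp
        linarith
      · rw [Set.indicator_of_notMem hω]
        exact zero_le
    refine hle.trans ?_
    rw [lintegral_const_mul' _ _ ENNReal.ofReal_ne_top]
    refine (mul_le_mul_right (wt_decay n hn μ hμ S hs n) _).trans ?_
    have hr : (3 * S.card / (5 * n) : ℝ) ≤ 1 := by
      rw [div_le_one (by positivity)]; linarith
    rw [← ENNReal.ofReal_pow (by linarith), ← ENNReal.ofReal_mul (pow_nonneg (by linarith) _),
      ← ENNReal.ofReal_mul (Real.exp_pos _).le]
    apply ENNReal.ofReal_le_ofReal
    have hpow : (1 - 3 * S.card / (5 * n) : ℝ) ^ n ≤ Real.exp (-(3 / 5 * S.card)) := by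
      calc (1 - 3 * S.card / (5 * n) : ℝ) ^ n ≤ (Real.exp (-(3 * S.card / (5 * n)))) ^ n := by
            apply pow_le_pow_left₀ (by linarith)
            have := Real.add_one_le_exp (-(3 * S.card / (5 * n)) : ℝ)
            linarith
        _ = _ := by
            rw [← Real.exp_nat_mul]
            congr 1
            field_simp
    calc _ ≤ Real.exp (6 / 5 * S.card) *
          (Real.exp (-(3 / 5 * S.card)) * Real.exp (-(S.card : ℝ))) := by gcongr
      _ = Real.exp (-(2 / 5 * S.card)) := by
          rw [← Real.exp_add, ← Real.exp_add]; congr 1; ring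
      _ ≤ Real.exp (-(2 * Real.log n)) := by
          apply Real.exp_le_exp.2; linarith
      _ = 1 / n ^ 2 := by
          rw [Real.exp_neg, one_div, two_mul, Real.exp_add, Real.exp_log (by linarith), sq]
  have h1 : 1 ≤ μ A + μ Aᶜ := by
    rw [← measure_univ (μ := μ), ← Set.union_compl_self A]
    exact measure_union_le _ _
  rw [ge_iff_le, tsub_le_iff_right]
  exact h1.trans (by gcongr)

end
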